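/- Let Ω be a properly convex quasi-homogeneous affine domain in ℝⁿ (n ≥ 1) such that Aut(Ω) is irreducible and the limit set Λ_{Aut⁰(Ω)} of the identity component of Aut(Ω) is nonempty. Then the closure of the convex hull of Λ_{Aut⁰(Ω)} equals the closure of Ω, and every extreme point of the closure of Ω lies in the closure of Λ_{Aut⁰(Ω)}. -/

import Mathlib

open Matrix Set Filter Topology Pointwise

noncomputable section

/-- The affine action on ℝⁿ of an (n+1)×(n+1) invertible matrix in affine form
(ℝⁿ is identified with the hyperplane x_{n+1} = 1). -/
def affAct (n : ℕ) (g : GL (Fin (n + 1)) ℝ) (x : Fin n → ℝ) : Fin n → ℝ :=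
  fun i => (∑ j : Fin n, g.val i.castSucc j.castSucc * x j) + g.val i.castSucc (Fin.last n)

/-- A matrix in GL(n+1,ℝ) has affine form if its last row is (0, …, 0, 1). -/
def IsAffineForm (n : ℕ) (g : GL (Fin (n + 1)) ℝ) : Prop :=
  (∀ j : Fin n, g.val (Fin.last n) j.castSucc = 0) ∧ g.val (Fin.last n) (Fin.last n) = 1

/-- Aut(Ω): the group (here: set) of affine transformations of ℝⁿ preserving Ω,
realized as affine-form matrices in GL(n+1,ℝ). -/
def AutSet (n : ℕ) (Ω : Set (Fin n → ℝ)) : Set (GL (Fin (n + 1)) ℝ) :=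
  {g | IsAffineForm n g ∧ affAct n g '' Ω = Ω}

/-- Aut⁰(Ω): the identity component of Aut(Ω). -/
def AutIdComp (n : ℕ) (Ω : Set (Fin n → ℝ)) : Set (GL (Fin (n + 1)) ℝ) :=
  connectedComponentIn (AutSet n Ω) 1

/-- The limit set Λ_G of a subset G of Aut(Ω). -/
def limitSet (n : ℕ) (Ω : Set (Fin n → ℝ)) (G : Set (GL (Fin (n + 1)) ℝ)) :
    Set (Fin n → ℝ) :=
  {ξ | ξ ∈ frontier Ω ∧ ∃ x ∈ Ω, ∃ u : ℕ → GL (Fin (n + 1)) ℝ,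
    (∀ k, u k ∈ G) ∧ Filter.Tendsto (fun k => affAct n (u k) x) Filter.atTop (nhds ξ)}

/-- Ω is a convex affine domain: a nonempty open convex subset of ℝⁿ. -/
def IsConvexDomain (n : ℕ) (Ω : Set (Fin n → ℝ)) : Prop :=
  Ω.Nonempty ∧ IsOpen Ω ∧ Convex ℝ Ω

/-- Ω contains no complete affine line. -/
def HasNoLine (n : ℕ) (Ω : Set (Fin n → ℝ)) : Prop :=
  ¬ ∃ x ∈ Ω, ∃ v : Fin n → ℝ, v ≠ 0 ∧ ∀ t : ℝ, x + t • v ∈ Ω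

/-- Ω is a properly convex affine domain. -/
def IsProperlyConvexDomain (n : ℕ) (Ω : Set (Fin n → ℝ)) : Prop :=
  IsConvexDomain n Ω ∧ HasNoLine n Ω

/-- Ω is quasi-homogeneous: some compact K ⊆ Ω has ⋃_{g ∈ Aut(Ω)} g(K) = Ω. -/
def IsQuasiHomogeneous (n : ℕ) (Ω : Set (Fin n → ℝ)) : Prop :=
  ∃ K : Set (Fin n → ℝ), IsCompact K ∧ K ⊆ Ω ∧
    (⋃ g ∈ AutSet n Ω, affAct n g '' K) = Ω

/-- Aut(Ω) is irreducible: it preserves no nonempty proper affine subspace of ℝⁿ. -/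
def IsIrreducibleAut (n : ℕ) (Ω : Set (Fin n → ℝ)) : Prop :=
  ¬ ∃ S : AffineSubspace ℝ (Fin n → ℝ), (S : Set (Fin n → ℝ)).Nonempty ∧
      (S : Set (Fin n → ℝ)) ≠ Set.univ ∧
      ∀ g ∈ AutSet n Ω, affAct n g '' (S : Set (Fin n → ℝ)) = (S : Set (Fin n → ℝ))

/-- The asymptotic cone AC(Ω). -/
def asympCone (n : ℕ) (Ω : Set (Fin n → ℝ)) : Set (Fin n → ℝ) :=
  {u | ∀ x ∈ Ω, ∀ t : ℝ, 0 ≤ t → x + t • u ∈ Ω}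

/-- Ω is a cone with some vertex v. -/
def IsCone (n : ℕ) (Ω : Set (Fin n → ℝ)) : Prop :=
  ∃ v : Fin n → ℝ, ∀ x ∈ Ω, ∀ t : ℝ, 0 < t → v + t • (x - v) ∈ Ω

/-- Two subsets of ℝⁿ are affinely equivalent. -/
def AffinelyEquivalent (n : ℕ) (Ω Ω' : Set (Fin n → ℝ)) : Prop :=
  ∃ e : (Fin n → ℝ) ≃ᵃ[ℝ] (Fin n → ℝ), e '' Ω = Ω'

/-- Γ acts freely on Ω. -/
def ActsFreely (n : ℕ) (Ω : Set (Fin n → ℝ)) (Γ : Set (GL (Fin (n + 1)) ℝ)) : Prop :=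
  ∀ γ ∈ Γ, γ ≠ 1 → ∀ x ∈ Ω, affAct n γ x ≠ x

/-- Γ acts properly discontinuously on Ω. -/
def ActsProperlyDiscontinuously (n : ℕ) (Ω : Set (Fin n → ℝ))
    (Γ : Set (GL (Fin (n + 1)) ℝ)) : Prop :=
  ∀ K L : Set (Fin n → ℝ), K ⊆ Ω → L ⊆ Ω → IsCompact K → IsCompact L →
    {γ ∈ Γ | (affAct n γ '' K ∩ L).Nonempty}.Finite

/-- Γ acts cocompactly on Ω. -/
def ActsCocompactly (n : ℕ) (Ω : Set (Fin n → ℝ)) (Γ : Set (GL (Fin (n + 1)) ℝ)) : Prop :=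
  ∃ K : Set (Fin n → ℝ), IsCompact K ∧ K ⊆ Ω ∧ (⋃ γ ∈ Γ, affAct n γ '' K) = Ω

/-- The linear part of an affine-form matrix has determinant one. -/
def LinearPartDetOne (n : ℕ) (g : GL (Fin (n + 1)) ℝ) : Prop :=
  (Matrix.of fun i j : Fin n => g.val i.castSucc j.castSucc).det = 1

section ConvexGeometry

variable {E : Type*} [NormedAddCommGroup E] [NormedSpace ℝ E] {Ω : Set E}

lemma add_smul_mem_of_forall_mem_closure (ho : IsOpen Ω) (hc : Convex ℝ Ω) {x w : E}
    (hx : x ∈ Ω) (h : ∀ t : ℝ, x + t • w ∈ closure Ω) (t : ℝ) : x + t • w ∈ Ω := by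
  have h1 := hc.openSegment_interior_closure_subset_interior
    (by rwa [ho.interior_eq]) (h (2 * t))
  rw [ho.interior_eq] at h1
  refine h1 ⟨1 / 2, 1 / 2, by norm_num, by norm_num, by norm_num, ?_⟩
  module

/-- An open convex set without lines has bounded symmetric part about each of its points. -/
lemma isBounded_setOf_add_sub_mem_closure [ProperSpace E] (ho : IsOpen Ω) (hc : Convex ℝ Ω)
    {x : E} (hx : x ∈ Ω) (hl : ∀ v : E, v ≠ 0 → ∃ t : ℝ, x + t • v ∉ Ω) :
    Bornology.IsBounded {v : E | x + v ∈ closure Ω ∧ x - v ∈ closure Ω} := by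
  have hcl : Convex ℝ (closure Ω) := hc.closure
  have hxc : x ∈ closure Ω := subset_closure hx
  have shrink : ∀ v : E, x + v ∈ closure Ω → ∀ r : ℝ, 0 ≤ r → r ≤ 1 →
      x + r • v ∈ closure Ω := by
    intro v hv r hr0 hr1
    have := hcl hxc hv (sub_nonneg.2 hr1) hr0 (by ring)
    convert this using 1
    module
  let U : ℕ → Set E := fun k =>
    {w | ¬ (x + (k : ℝ) • w ∈ closure Ω ∧ x + (k : ℝ) • (-w) ∈ closure Ω)}
  have hUo : ∀ k, IsOpen (U k) := by
    intro k
    have : IsClosed {w : E | x + (k : ℝ) • w ∈ closure Ω ∧ x + (k : ℝ) • (-w) ∈ closure Ω} :=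
      (isClosed_closure.preimage (by fun_prop : Continuous fun w : E => x + (k : ℝ) • w)).inter
        (isClosed_closure.preimage (by fun_prop : Continuous fun w : E => x + (k : ℝ) • (-w)))
    exact this.isOpen_compl
  have hanti : ∀ (k : ℝ) (l : ℝ), 0 ≤ k → k ≤ l → ∀ w : E, x + l • w ∈ closure Ω →
      x + k • w ∈ closure Ω := by
    intro k l hk hkl w hw
    rcases hk.eq_or_lt with rfl | hk
    · simpa using hxc
    · have hl0 : 0 < l := hk.trans_le hkl
      have := shrink _ hw (k / l) (by positivity) ((div_le_one hl0).2 hkl)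
      rwa [smul_smul, div_mul_cancel₀ _ hl0.ne'] at this
  have hmono : Monotone U := by
    intro k l hkl w hw h
    exact hw ⟨hanti k l (by positivity) (by exact_mod_cast hkl) w h.1,
      hanti k l (by positivity) (by exact_mod_cast hkl) (-w) h.2⟩
  have hcover : Metric.sphere (0 : E) 1 ⊆ ⋃ k, U k := by
    intro w hw
    by_contra hcon
    simp only [mem_iUnion, not_exists, U, mem_ofPred_eq, not_not] at hcon
    have hw0 : w ≠ 0 := by
      rintro rfl
      simp at hw
    obtain ⟨t, ht⟩ := hl w hw0
    refine ht (add_smul_mem_of_forall_mem_closure ho hc hx (fun s => ?_) t)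
    obtain ⟨k, hk⟩ := exists_nat_ge |s|
    rcases le_total 0 s with hs | hs
    · exact hanti s k hs ((le_abs_self s).trans hk) w (hcon k).1
    · have := hanti (-s) k (neg_nonneg.2 hs) ((neg_le_abs s).trans hk) (-w) (hcon k).2
      simpa using this
  obtain ⟨k, hk⟩ := (isCompact_sphere (0 : E) 1).elim_directed_cover U hUo hcover
    (directed_of_isDirected_le hmono)
  refine isBounded_iff_forall_norm_le.2 ⟨k, fun v hv => ?_⟩
  by_contra! hlt
  have hv0 : 0 < ‖v‖ := lt_of_le_of_lt (by positivity) hlt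
  have hs : ‖v‖⁻¹ • v ∈ Metric.sphere (0 : E) 1 := by
    simp [norm_smul, hv0.ne']
  have hscale : ‖v‖ • (‖v‖⁻¹ • v) = v := by
    rw [smul_smul, mul_inv_cancel₀ hv0.ne', one_smul]
  refine hk hs ⟨hanti k ‖v‖ (by positivity) hlt.le _ ?_, hanti k ‖v‖ (by positivity) hlt.le _ ?_⟩
  · rw [hscale]
    exact hv.1
  · rw [smul_neg, hscale, ← sub_eq_add_neg]
    exact hv.2

/-- Uniform version of `isBounded_setOf_add_sub_mem_closure` over a bounded set of centres. -/
lemma isBounded_setOf_exists_add_sub_mem_closure [ProperSpace E] (ho : IsOpen Ω)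
    (hc : Convex ℝ Ω) {x : E} (hx : x ∈ Ω) (hl : ∀ v : E, v ≠ 0 → ∃ t : ℝ, x + t • v ∉ Ω)
    {M : Set E} (hM : Bornology.IsBounded M) :
    Bornology.IsBounded {v : E | ∃ m ∈ M, m + v ∈ closure Ω ∧ m - v ∈ closure Ω} := by
  obtain ⟨R, hR⟩ := isBounded_iff_forall_norm_le.1
    (isBounded_setOf_add_sub_mem_closure ho hc hx hl)
  obtain ⟨r, hr, hball⟩ := Metric.isOpen_iff.1 ho x hx
  obtain ⟨B, hB⟩ := isBounded_iff_forall_norm_le.1 hM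
  let D : ℝ := |B| + ‖x‖ + 1
  have hD : 0 < D := by positivity
  let s : ℝ := r / (2 * D)
  have hs : 0 < s := by positivity
  refine isBounded_iff_forall_norm_le.2 ⟨R * ((1 + s) / s), ?_⟩
  rintro v ⟨m, hm, hv1, hv2⟩
  have hm' : x + s • (x - m) ∈ closure Ω := by
    refine subset_closure (hball ?_)
    rw [mem_ball_iff_norm, add_sub_cancel_left, norm_smul, Real.norm_of_nonneg hs.le]
    have h1 : ‖x - m‖ ≤ D := by
      have := norm_sub_le x m
      have := hB m hm
      have := le_abs_self B
      simp only [D]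
      linarith
    calc s * ‖x - m‖ ≤ s * D := by gcongr
      _ = r / 2 := by simp only [s]; field_simp
      _ < r := by linarith
  have key : ∀ u : E, m + u ∈ closure Ω → x + (s / (1 + s)) • u ∈ closure Ω := by
    intro u hu
    have := hc.closure hm' hu (a := 1 / (1 + s)) (b := s / (1 + s)) (by positivity)
      (by positivity) (by field_simp)
    convert this using 1
    match_scalars <;> field_simp; ring
  have h := hR ((s / (1 + s)) • v) ⟨key v hv1, by
    have := key (-v) (by rwa [← sub_eq_add_neg])
    rwa [smul_neg, ← sub_eq_add_neg] at this⟩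
  rw [norm_smul, Real.norm_of_nonneg (by positivity)] at h
  calc ‖v‖ = (s / (1 + s) * ‖v‖) * ((1 + s) / s) := by field_simp
    _ ≤ R * ((1 + s) / s) := by gcongr

/-- If each point of `Ω` is a combination, with fixed weights, of a point of `T` and a point of
`closure Ω`, then `T` accumulates at each extreme point of `closure Ω`. -/
lemma extremePoints_closure_subset_closure [ProperSpace E] (ho : IsOpen Ω)
    (hc : Convex ℝ Ω) {x : E} (hx : x ∈ Ω) (hl : ∀ v : E, v ≠ 0 → ∃ t : ℝ, x + t • v ∉ Ω)
    {T : Set E} (hT : T ⊆ closure Ω) {r : ℝ} (hr0 : 0 < r) (hr1 : r < 1)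
    (h : ∀ y ∈ Ω, ∃ a ∈ T, ∃ b ∈ closure Ω, r • a + (1 - r) • b = y) :
    Set.extremePoints ℝ (closure Ω) ⊆ closure T := by
  intro ξ hξ
  obtain ⟨y, hy, hyξ⟩ := mem_closure_iff_seq_limit.1 hξ.1
  choose! a haT b hb hab using h
  obtain ⟨R, hR⟩ := isBounded_iff_forall_norm_le.1
    (isBounded_setOf_exists_add_sub_mem_closure ho hc hx hl
      (Metric.isBounded_range_of_tendsto y hyξ))
  obtain ⟨B, hB⟩ := isBounded_iff_forall_norm_le.1 (Metric.isBounded_range_of_tendsto y hyξ)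
  have hcl := hc.closure
  have hr1' : 0 < 1 - r := sub_pos.2 hr1
  have habd : ∀ k, ‖a (y k)‖ ≤ B + (1 / r) * R := by
    intro k
    have e := hab _ (hy k)
    have hv := hR ((r * (1 - r)) • (a (y k) - b (y k))) ⟨y k, mem_range_self k, by
      have := hcl (hT (haT _ (hy k))) (hb _ (hy k)) (a := r + r * (1 - r))
        (b := 1 - (r + r * (1 - r))) (by positivity) (by nlinarith) (by ring)
      convert this using 1
      nth_rewrite 1 [← e]
      module, by
      have := hcl (hT (haT _ (hy k))) (hb _ (hy k)) (a := r - r * (1 - r))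
        (b := 1 - (r - r * (1 - r))) (by nlinarith) (by nlinarith) (by ring)
      convert this using 1
      nth_rewrite 1 [← e]
      module⟩
    have e2 : a (y k) = y k + (1 / r) • ((r * (1 - r)) • (a (y k) - b (y k))) := by
      nth_rewrite 2 [← e]
      match_scalars <;> field_simp <;> ring
    calc ‖a (y k)‖ = ‖y k + (1 / r) • ((r * (1 - r)) • (a (y k) - b (y k)))‖ := by rw [← e2]
      _ ≤ ‖y k‖ + ‖(1 / r) • ((r * (1 - r)) • (a (y k) - b (y k)))‖ := norm_add_le _ _
      _ ≤ B + (1 / r) * R := by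
        rw [norm_smul (1 / r), Real.norm_of_nonneg (by positivity : 0 ≤ 1 / r)]
        gcongr
        exact hB _ (mem_range_self k)
  obtain ⟨α, -, φ, hφ, hlim⟩ := tendsto_subseq_of_bounded
    (Metric.isBounded_closedBall (x := (0 : E)) (r := B + (1 / r) * R))
    (x := fun k => a (y k)) (fun k => by simpa using habd k)
  have hα : α ∈ closure T :=
    mem_closure_of_tendsto hlim (Eventually.of_forall fun k => haT _ (hy _))
  have hαΩ : α ∈ closure Ω := closure_minimal hT isClosed_closure hα
  have hblim : Tendsto (fun k => b (y (φ k))) atTop (𝓝 ((1 - r)⁻¹ • (ξ - r • α))) := by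
    have h1 : Tendsto (fun k => (1 - r)⁻¹ • (y (φ k) - r • a (y (φ k)))) atTop
        (𝓝 ((1 - r)⁻¹ • (ξ - r • α))) :=
      ((hyξ.comp hφ.tendsto_atTop).sub (hlim.const_smul r)).const_smul _
    refine h1.congr fun k => ?_
    rw [inv_smul_eq_iff₀ hr1'.ne', sub_eq_iff_eq_add', hab _ (hy _)]
  have hβ : (1 - r)⁻¹ • (ξ - r • α) ∈ closure Ω :=
    isClosed_closure.mem_of_tendsto hblim (Eventually.of_forall fun k => hb _ (hy _))
  have := hξ.2 hαΩ hβ ⟨r, 1 - r, hr0, hr1', by ring, by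
    rw [smul_inv_smul₀ hr1'.ne']
    abel⟩
  rwa [← this]

/-- If each point of `Ω` is at uniformly bounded Hilbert distance from a point of `C ∩ Ω`,
then `C` is dense in `Ω`. -/
lemma subset_closure_of_uniform_combination [ProperSpace E] (ho : IsOpen Ω)
    (hc : Convex ℝ Ω) (hl : ∀ x ∈ Ω, ∀ v : E, v ≠ 0 → ∃ t : ℝ, x + t • v ∉ Ω)
    {C : Set E} (hC : Convex ℝ C) {d : ℝ} (hd0 : 0 < d) (hd1 : d < 1)
    (h : ∀ y ∈ Ω, ∃ c ∈ C, (∃ z ∈ Ω, d • c + (1 - d) • z = y) ∧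
      ∃ z ∈ Ω, d • y + (1 - d) • z = c) :
    Ω ⊆ closure C := by
  intro x hx
  by_contra hxC
  obtain ⟨f, a, hfa, hax⟩ := geometric_hahn_banach_closed_point hC.closure isClosed_closure hxC
  obtain ⟨R, hR⟩ := isBounded_iff_forall_norm_le.1
    (isBounded_setOf_add_sub_mem_closure ho hc hx (hl x hx))
  -- the pairs `(s, y)` stand for the vectors `s • (y, 1)` in the order interval `[0, (x, 1)]`
  let I : ℝ → E → Prop := fun s y => 0 < s ∧ s < 1 ∧ y ∈ Ω ∧ ∃ z ∈ Ω, s • y + (1 - s) • z = x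
  have hbdd : ∀ s y, I s y → s * (f y - a) ≤ ‖f‖ * R + (f x - a) := by
    rintro s y ⟨hs0, hs1, hy, z, hz, hxyz⟩
    have hv := hR (s • (y - x)) ⟨subset_closure (by
      have := hc hx hy (sub_nonneg.2 hs1.le) hs0.le (by ring)
      convert this using 1
      module), subset_closure (by
      have := hc hx hz hs0.le (sub_nonneg.2 hs1.le) (by ring)
      convert this using 1
      nth_rewrite 1 [← hxyz]
      module)⟩
    have h1 : f (s • (y - x)) ≤ ‖f‖ * R :=
      (le_abs_self _).trans ((f.le_opNorm _).trans (by gcongr))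
    have h2 : f (s • (y - x)) = s * (f y - f x) := by simp
    nlinarith
  have hη : 0 < 1 - d ^ 2 := by nlinarith
  have hstep : ∀ s y, I s y → ∃ s' y', I s' y' ∧
      s * (f y - a) ≤ (1 - d ^ 2) * (s' * (f y' - a)) := by
    rintro s y ⟨hs0, hs1, hy, z, hz, hxyz⟩
    obtain ⟨c, hcC, ⟨y', hy', e1⟩, w, hw, e2⟩ := h y hy
    have hlt : s / (1 + d) < s := div_lt_self hs0 (by linarith)
    have h1s : 0 < 1 - s / (1 + d) := by linarith
    refine ⟨s / (1 + d), y', ⟨by positivity, by linarith, hy', ?_⟩, ?_⟩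
    · refine ⟨(1 - s / (1 + d))⁻¹ • ((s * d / (1 + d)) • w + (1 - s) • z), ?_, ?_⟩
      · have := hc hw hz (a := (1 - s / (1 + d))⁻¹ * (s * d / (1 + d)))
          (b := (1 - s / (1 + d))⁻¹ * (1 - s)) (by positivity)
          (mul_nonneg (by positivity) (by linarith)) (by
            rw [← mul_add, inv_mul_eq_one₀ h1s.ne']
            field_simp
            ring)
        convert this using 1
        module
      · rw [smul_inv_smul₀ h1s.ne', ← hxyz]
        have hy'e : y = (1 + d)⁻¹ • y' + (d / (1 + d)) • w := by
          have hd' : (1 - d) • ((1 + d) • y) = (1 - d) • (y' + d • w) := by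
            have : (1 - d) • y' = y - d • c := by rw [← e1]; abel
            have e2' : (1 - d) • w = c - d • y := by rw [← e2]; abel
            rw [smul_add, smul_comm (1 - d) d w, this, e2']
            module
          have := smul_right_injective E (sub_ne_zero.2 hd1.ne') hd'
          rw [← inv_smul_smul₀ (by positivity : 1 + d ≠ 0) y, this]
          match_scalars <;> field_simp
        rw [hy'e]
        match_scalars <;> field_simp
    · have hfc : f c < a := hfa c (subset_closure hcC)
      have hfy : f y = d * f c + (1 - d) * f y' := by rw [← e1]; simp
      have : (1 - d ^ 2) * (s / (1 + d) * (f y' - a)) = s * ((1 - d) * (f y' - a)) := by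
        field_simp
        ring
      rw [this, hfy]
      have : d * f c ≤ d * a := by gcongr
      nlinarith
  have hiter : ∀ k : ℕ, ∃ s y, I s y ∧
      (1 / 2) * (f x - a) ≤ (1 - d ^ 2) ^ k * (s * (f y - a)) := by
    intro k
    induction k with
    | zero => exact ⟨1 / 2, x, ⟨by norm_num, by norm_num, hx, x, hx, by module⟩, by simp⟩
    | succ k ih =>
      obtain ⟨s, y, hI, hle⟩ := ih
      obtain ⟨s', y', hI', hle'⟩ := hstep s y hI
      refine ⟨s', y', hI', hle.trans ?_⟩
      rw [pow_succ (1 - d ^ 2), mul_assoc]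
      gcongr
  have hlim : Tendsto (fun k : ℕ => (1 - d ^ 2) ^ k * (‖f‖ * R + (f x - a))) atTop (𝓝 0) := by
    have := (tendsto_pow_atTop_nhds_zero_of_lt_one hη.le (by nlinarith : 1 - d ^ 2 < 1)).mul_const
      (‖f‖ * R + (f x - a))
    simpa using this
  have : (1 / 2) * (f x - a) ≤ 0 := ge_of_tendsto' hlim fun k => by
    obtain ⟨s, y, hI, hle⟩ := hiter k
    exact hle.trans (by gcongr; exact hbdd s y hI)
  linarith

/-- For a compact `K` in an open set `U` and a point `c`, extending segments from `c` slightly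
beyond `K` stays in `U`, and so does extending from `K` beyond `c`. -/
lemma exists_uniform_combination (ho : IsOpen Ω) {K : Set E} (hK : IsCompact K) (hKΩ : K ⊆ Ω)
    {c : E} (hc : c ∈ Ω) :
    ∃ d : ℝ, 0 < d ∧ d < 1 ∧ ∀ k ∈ K, (∃ z ∈ Ω, d • c + (1 - d) • z = k) ∧
      ∃ z ∈ Ω, d • k + (1 - d) • z = c := by
  have hev : ∀ p q : E → E, Continuous p → Continuous q → (∀ k ∈ K, q k ∈ Ω) →
      ∀ᶠ d : ℝ in 𝓝 0, ∀ k ∈ K, (1 - d)⁻¹ • (q k - d • p k) ∈ Ω := by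
    intro p q hp hq hqΩ
    refine hK.eventually_forall_of_forall_eventually fun k hk => ?_
    have hcont : ContinuousAt
        (fun t : ℝ × E => (1 - t.1)⁻¹ • (q t.2 - t.1 • p t.2)) (0, k) := by
      refine ContinuousAt.smul (ContinuousAt.inv₀ (by fun_prop) (by simp)) ?_
      fun_prop
    exact hcont.preimage_mem_nhds (ho.mem_nhds (by simpa using hqΩ k hk))
  have h1 := hev (fun _ => c) id continuous_const continuous_id hKΩ
  have h2 := hev id (fun _ => c) continuous_id continuous_const (fun _ _ => hc)
  have h3 : ∀ᶠ d : ℝ in 𝓝 0, d < 1 := Iio_mem_nhds one_pos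
  obtain ⟨d, ⟨hd1, hd2, hd3⟩, hd0⟩ :=
    (((h1.and (h2.and h3)).filter_mono nhdsWithin_le_nhds).and
      (self_mem_nhdsWithin (s := Ioi (0 : ℝ)))).exists
  have hne : 1 - d ≠ 0 := (sub_pos.2 hd3).ne'
  refine ⟨d, hd0, hd3, fun k hk => ⟨⟨_, hd1 k hk, ?_⟩, _, hd2 k hk, ?_⟩⟩ <;>
  · rw [smul_inv_smul₀ hne]
    simp

end ConvexGeometry

section AffineAction

variable {n : ℕ} {Ω : Set (Fin n → ℝ)}

lemma mulVec_snoc_one {g : GL (Fin (n + 1)) ℝ} (hg : IsAffineForm n g) (x : Fin n → ℝ) :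
    g.val *ᵥ (Fin.snoc x 1 : Fin (n + 1) → ℝ) = Fin.snoc (affAct n g x) 1 := by
  ext i
  refine Fin.lastCases ?_ (fun i => ?_) i
  · simp [Matrix.mulVec, dotProduct, Fin.sum_univ_castSucc, hg.1, hg.2]
  · simp [Matrix.mulVec, dotProduct, Fin.sum_univ_castSucc, affAct]

lemma isAffineForm_iff_vecMul {g : GL (Fin (n + 1)) ℝ} :
    IsAffineForm n g ↔ Pi.single (Fin.last n) 1 ᵥ* g.val = Pi.single (Fin.last n) 1 := by
  rw [Matrix.single_one_vecMul, funext_iff, Fin.forall_fin_succ']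
  simp [IsAffineForm, Matrix.row]

lemma IsAffineForm.mul {g h : GL (Fin (n + 1)) ℝ} (hg : IsAffineForm n g)
    (hh : IsAffineForm n h) : IsAffineForm n (g * h) := by
  rw [isAffineForm_iff_vecMul] at *
  rw [Units.val_mul, ← Matrix.vecMul_vecMul, hg, hh]

lemma IsAffineForm.inv {g : GL (Fin (n + 1)) ℝ} (hg : IsAffineForm n g) :
    IsAffineForm n g⁻¹ := by
  rw [isAffineForm_iff_vecMul] at *
  nth_rewrite 1 [← hg]
  rw [Matrix.vecMul_vecMul, ← Units.val_mul, mul_inv_cancel, Units.val_one, Matrix.vecMul_one]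

lemma isAffineForm_one : IsAffineForm n 1 := by
  simp [isAffineForm_iff_vecMul]

lemma affAct_mul {g h : GL (Fin (n + 1)) ℝ} (hg : IsAffineForm n g) (hh : IsAffineForm n h)
    (x : Fin n → ℝ) : affAct n (g * h) x = affAct n g (affAct n h x) := by
  have := mulVec_snoc_one (hg.mul hh) x
  rw [Units.val_mul, ← Matrix.mulVec_mulVec, mulVec_snoc_one hh, mulVec_snoc_one hg] at this
  exact ((Fin.snoc_inj.1 this).1).symm

lemma affAct_one (x : Fin n → ℝ) : affAct n 1 x = x := by
  have := mulVec_snoc_one isAffineForm_one x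
  rw [Units.val_one, Matrix.one_mulVec] at this
  exact ((Fin.snoc_inj.1 this).1).symm

/-- The affine map underlying `affAct n g`. -/
def affActMap (g : GL (Fin (n + 1)) ℝ) : (Fin n → ℝ) →ᵃ[ℝ] (Fin n → ℝ) :=
  ((g.val.submatrix Fin.castSucc Fin.castSucc).mulVecLin).toAffineMap +
    AffineMap.const ℝ _ (fun i : Fin n => g.val i.castSucc (Fin.last n))

lemma coe_affActMap (g : GL (Fin (n + 1)) ℝ) : ⇑(affActMap g) = affAct n g := by
  ext x i
  simp [affActMap, affAct, Matrix.mulVec, dotProduct]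

lemma affAct_combo (g : GL (Fin (n + 1)) ℝ) (a : ℝ) (x y : Fin n → ℝ) :
    affAct n g (a • x + (1 - a) • y) = a • affAct n g x + (1 - a) • affAct n g y := by
  rw [← coe_affActMap]
  exact Convex.combo_affine_apply (by ring)

lemma continuous_affAct (g : GL (Fin (n + 1)) ℝ) : Continuous (affAct n g) := by
  rw [← coe_affActMap]
  exact (affActMap g).continuous_of_finiteDimensional

lemma one_mem_AutSet : (1 : GL (Fin (n + 1)) ℝ) ∈ AutSet n Ω :=
  ⟨isAffineForm_one, by simp [affAct_one]⟩

lemma mul_mem_AutSet {g h : GL (Fin (n + 1)) ℝ} (hg : g ∈ AutSet n Ω) (hh : h ∈ AutSet n Ω) :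
    g * h ∈ AutSet n Ω := by
  refine ⟨hg.1.mul hh.1, ?_⟩
  rw [funext (affAct_mul hg.1 hh.1), ← image_image (affAct n g), hh.2, hg.2]

lemma affAct_inv_affAct {g : GL (Fin (n + 1)) ℝ} (hg : IsAffineForm n g) (x : Fin n → ℝ) :
    affAct n g⁻¹ (affAct n g x) = x := by
  rw [← affAct_mul hg.inv hg, inv_mul_cancel, affAct_one]

lemma affAct_affAct_inv {g : GL (Fin (n + 1)) ℝ} (hg : IsAffineForm n g) (x : Fin n → ℝ) :
    affAct n g (affAct n g⁻¹ x) = x := by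
  rw [← affAct_mul hg hg.inv, mul_inv_cancel, affAct_one]

lemma inv_mem_AutSet {g : GL (Fin (n + 1)) ℝ} (hg : g ∈ AutSet n Ω) : g⁻¹ ∈ AutSet n Ω := by
  refine ⟨hg.1.inv, ?_⟩
  nth_rewrite 1 [← hg.2]
  simp [image_image, affAct_inv_affAct hg.1]

/-- The homeomorphism of affine space underlying an affine-form matrix. -/
def affActHomeomorph {g : GL (Fin (n + 1)) ℝ} (hg : IsAffineForm n g) :
    (Fin n → ℝ) ≃ₜ (Fin n → ℝ) where
  toFun := affAct n g
  invFun := affAct n g⁻¹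
  left_inv := affAct_inv_affAct hg
  right_inv := affAct_affAct_inv hg
  continuous_toFun := continuous_affAct g
  continuous_invFun := continuous_affAct g⁻¹

lemma affAct_mem {g : GL (Fin (n + 1)) ℝ} (hg : g ∈ AutSet n Ω) {x : Fin n → ℝ} (hx : x ∈ Ω) :
    affAct n g x ∈ Ω :=
  hg.2 ▸ mem_image_of_mem _ hx

lemma affAct_mem_frontier {g : GL (Fin (n + 1)) ℝ} (hg : g ∈ AutSet n Ω) {x : Fin n → ℝ}
    (hx : x ∈ frontier Ω) : affAct n g x ∈ frontier Ω := by
  have h := (affActHomeomorph hg.1).image_frontier Ω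
  have h2 : affActHomeomorph hg.1 '' Ω = Ω := hg.2
  rw [h2] at h
  rw [← h]
  exact mem_image_of_mem (affActHomeomorph hg.1) hx

lemma conj_mem_AutIdComp {g u : GL (Fin (n + 1)) ℝ} (hg : g ∈ AutSet n Ω)
    (hu : u ∈ AutIdComp n Ω) : g * u * g⁻¹ ∈ AutIdComp n Ω := by
  have hpre : IsPreconnected ((fun v => g * v * g⁻¹) '' AutIdComp n Ω) :=
    isPreconnected_connectedComponentIn.image _ (by fun_prop)
  refine hpre.subset_connectedComponentIn (x := 1) ?_ ?_ (mem_image_of_mem _ hu)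
  · exact ⟨1, mem_connectedComponentIn one_mem_AutSet, by simp⟩
  · rintro _ ⟨v, hv, rfl⟩
    exact mul_mem_AutSet (mul_mem_AutSet hg (connectedComponentIn_subset _ _ hv))
      (inv_mem_AutSet hg)

/-- The limit set of the identity component is invariant under the full automorphism group. -/
lemma affAct_mem_limitSet {g : GL (Fin (n + 1)) ℝ} (hg : g ∈ AutSet n Ω) {ξ : Fin n → ℝ}
    (hξ : ξ ∈ limitSet n Ω (AutIdComp n Ω)) : affAct n g ξ ∈ limitSet n Ω (AutIdComp n Ω) := by
  obtain ⟨hfr, x, hx, u, hu, hlim⟩ := hξ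
  refine ⟨affAct_mem_frontier hg hfr, affAct n g x, affAct_mem hg hx,
    fun k => g * u k * g⁻¹, fun k => conj_mem_AutIdComp hg (hu k), ?_⟩
  refine (((continuous_affAct g).tendsto ξ).comp hlim).congr fun k => ?_
  have huk : IsAffineForm n (u k) := (connectedComponentIn_subset _ _ (hu k)).1
  rw [Function.comp_apply, affAct_mul (hg.1.mul huk) hg.1.inv, affAct_inv_affAct hg.1,
    affAct_mul hg.1 huk]

lemma affAct_image_limitSet {g : GL (Fin (n + 1)) ℝ} (hg : g ∈ AutSet n Ω) :
    affAct n g '' limitSet n Ω (AutIdComp n Ω) = limitSet n Ω (AutIdComp n Ω) := by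
  refine Subset.antisymm (image_subset_iff.2 fun ξ hξ => affAct_mem_limitSet hg hξ) fun ξ hξ => ?_
  exact ⟨_, affAct_mem_limitSet (inv_mem_AutSet hg) hξ, affAct_affAct_inv hg.1 ξ⟩

lemma affineSpan_limitSet_eq_top (h3 : IsIrreducibleAut n Ω)
    (h4 : (limitSet n Ω (AutIdComp n Ω)).Nonempty) :
    affineSpan ℝ (limitSet n Ω (AutIdComp n Ω)) = ⊤ := by
  by_contra hne
  refine h3 ⟨affineSpan ℝ (limitSet n Ω (AutIdComp n Ω)), h4.mono (subset_affineSpan ℝ _),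
    fun h => hne (SetLike.coe_injective (by simpa using h)), fun g hg => ?_⟩
  rw [← coe_affActMap, ← AffineSubspace.coe_map, AffineSubspace.map_span, coe_affActMap,
    affAct_image_limitSet hg]

end AffineAction

/-- for a properly convex quasi-homogeneous domain with irreducible Aut(Ω)
and nonempty Λ_{Aut⁰(Ω)}, the closed convex hull of Λ_{Aut⁰(Ω)} is the closure of Ω and
the closure of Λ_{Aut⁰(Ω)} contains all extreme points. -/
theorem closure_convexHull_limitSet_eq (n : ℕ) (hn : 1 ≤ n) (Ω : Set (Fin n → ℝ))
    (h1 : IsProperlyConvexDomain n Ω) (h2 : IsQuasiHomogeneous n Ω)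
    (h3 : IsIrreducibleAut n Ω)
    (h4 : (limitSet n Ω (AutIdComp n Ω)).Nonempty) :
    closure (convexHull ℝ (limitSet n Ω (AutIdComp n Ω))) = closure Ω ∧
      Set.extremePoints ℝ (closure Ω) ⊆ closure (limitSet n Ω (AutIdComp n Ω)) := by
  obtain ⟨⟨⟨x₀, hx₀⟩, ho, hc⟩, hnl⟩ := h1
  obtain ⟨K, hK, hKΩ, hcov⟩ := h2
  have hl : ∀ x ∈ Ω, ∀ v : Fin n → ℝ, v ≠ 0 → ∃ t : ℝ, x + t • v ∉ Ω := by
    intro x hx v hv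
    by_contra! h
    exact hnl ⟨x, hx, v, hv, h⟩
  have hΛ : limitSet n Ω (AutIdComp n Ω) ⊆ closure Ω := fun ξ hξ => frontier_subset_closure hξ.1
  have hrep : ∀ y ∈ Ω, ∃ g ∈ AutSet n Ω, ∃ k ∈ K, affAct n g k = y := by
    intro y hy
    rw [← hcov] at hy
    simpa using hy
  refine ⟨Subset.antisymm ?_ ?_, ?_⟩
  · exact closure_minimal (convexHull_min hΛ hc.closure) isClosed_closure
  · obtain ⟨c, hcint⟩ := interior_convexHull_nonempty_iff_affineSpan_eq_top.2
      (affineSpan_limitSet_eq_top h3 h4)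
    have hcΩ : c ∈ Ω := by
      have h := interior_mono (convexHull_min hΛ hc.closure) hcint
      rwa [hc.interior_closure_eq_interior_of_nonempty_interior
        (by rw [ho.interior_eq]; exact ⟨x₀, hx₀⟩), ho.interior_eq] at h
    obtain ⟨d, hd0, hd1, hd⟩ := exists_uniform_combination ho hK hKΩ hcΩ
    refine closure_minimal (subset_closure_of_uniform_combination ho hc hl
      (convex_convexHull ℝ _) hd0 hd1 fun y hy => ?_) isClosed_closure
    obtain ⟨g, hg, k, hk, rfl⟩ := hrep y hy
    obtain ⟨⟨z, hz, e1⟩, w, hw, e2⟩ := hd k hk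
    refine ⟨affAct n g c, ?_, ⟨_, affAct_mem hg hz, ?_⟩, _, affAct_mem hg hw, ?_⟩
    · rw [← affAct_image_limitSet hg, ← coe_affActMap, ← AffineMap.image_convexHull]
      exact mem_image_of_mem _ (interior_subset hcint)
    · rw [← affAct_combo, e1]
    · rw [← affAct_combo, e2]
  · obtain ⟨s, hs⟩ := h4
    have hcΩ : (1 / 2 : ℝ) • x₀ + (1 / 2 : ℝ) • s ∈ Ω := by
      have h := hc.openSegment_interior_closure_subset_interior
        (by rwa [ho.interior_eq]) (hΛ hs)
        (⟨1 / 2, 1 / 2, by norm_num, by norm_num, by norm_num, rfl⟩ :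
          (1 / 2 : ℝ) • x₀ + (1 / 2 : ℝ) • s ∈ openSegment ℝ x₀ s)
      rwa [ho.interior_eq] at h
    obtain ⟨d, hd0, hd1, hd⟩ := exists_uniform_combination ho hK hKΩ hcΩ
    refine extremePoints_closure_subset_closure ho hc hx₀ (hl x₀ hx₀) hΛ (r := d / 2)
      (by linarith) (by linarith) fun y hy => ?_
    obtain ⟨g, hg, k, hk, rfl⟩ := hrep y hy
    obtain ⟨⟨z, hz, e1⟩, -⟩ := hd k hk
    have hpos : 0 < 1 - d / 2 := by linarith
    refine ⟨affAct n g s, affAct_mem_limitSet hg hs,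
      affAct n g ((1 - d / 2)⁻¹ • ((d / 2) • x₀ + (1 - d) • z)), subset_closure
        (affAct_mem hg ?_), ?_⟩
    · have := hc hx₀ hz (a := (1 - d / 2)⁻¹ * (d / 2)) (b := (1 - d / 2)⁻¹ * (1 - d))
        (by positivity) (mul_nonneg (by positivity) (by linarith)) (by
          rw [← mul_add, inv_mul_eq_one₀ hpos.ne']
          ring)
      convert this using 1
      module
    · rw [← affAct_combo, smul_inv_smul₀ hpos.ne', ← e1]
      congr 1
      module
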